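/- Let Γ be a countable, finitely presented, amenable group and let n ≥ 1. Let A be an n×n matrix with entries in the integral group ring ℤΓ which is invertible over ℤΓ, i.e. there exists an n×n matrix B over ℤΓ with AB = BA = I. Then the Fuglede–Kadison determinant of the induced operator R_A on ℓ²(Γ)ⁿ equals 1; equivalently, Re τ(log(R_A* R_A)) = 0, where log(R_A* R_A) is given by continuous functional calculus. (This is the statement that the Fuglede–Kadison determinant homomorphism Φ_Γ : Wh(Γ) → ℝ⁺ is trivial for finitely presented amenable groups.) -/

import Mathlib

set_option maxHeartbeats 1000000
set_option synthInstance.maxHeartbeats 1000000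

/-- Completeness of finite `L^p` products of complete spaces. -/
instance PiLp.instCompleteSpace {ι : Type} (p : ENNReal) (E : ι → Type)
    [∀ i, UniformSpace (E i)] [∀ i, CompleteSpace (E i)] : CompleteSpace (PiLp p E) :=
  PiLp.completeSpace p E

noncomputable section

open scoped ENNReal

/-- `ℓ²(Γ)`, the Hilbert space of square-summable complex functions on `Γ`. -/
abbrev l2 (Γ : Type) : Type := lp (fun _ : Γ => ℂ) 2

variable {Γ : Type} [Group Γ]

theorem translate_memℓp (γ : Γ) (f : l2 Γ) :
    Memℓp (fun x : Γ => f (x * γ)) (2 : ℝ≥0∞) := by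
  have h2 : (0:ℝ) < (2 : ℝ≥0∞).toReal := by norm_num
  apply memℓp_gen
  have hs : Summable fun i : Γ => ‖f i‖ ^ (2 : ℝ≥0∞).toReal := (lp.memℓp f).summable h2
  exact ((Equiv.mulRight γ).summable_iff (f := fun i : Γ => ‖f i‖ ^ (2 : ℝ≥0∞).toReal)).2 hs

/-- The right-translation unitary `(ρ_γ ξ)(x) = ξ(xγ)` on `ℓ²(Γ)`. -/
def rhoEquiv (γ : Γ) : l2 Γ ≃ₗᵢ[ℂ] l2 Γ where
  toFun f := ⟨fun x => f (x * γ), translate_memℓp γ f⟩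
  invFun f := ⟨fun x => f (x * γ⁻¹), translate_memℓp γ⁻¹ f⟩
  left_inv f := by ext x; simp
  right_inv f := by ext x; simp
  map_add' f g := by ext x; simp [lp.coeFn_add]; rfl
  map_smul' c f := by ext x; simp [lp.coeFn_smul]
  norm_map' f := by
    have h2 : (0:ℝ) < (2 : ℝ≥0∞).toReal := by norm_num
    have h1 := lp.norm_rpow_eq_tsum h2
      (⟨fun x => f (x * γ), translate_memℓp γ f⟩ : l2 Γ)
    have h3 := lp.norm_rpow_eq_tsum h2 f
    have h4 : ∑' x : Γ, ‖f (x * γ)‖ ^ (2 : ℝ≥0∞).toReal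
        = ∑' x : Γ, ‖f x‖ ^ (2 : ℝ≥0∞).toReal :=
      (Equiv.mulRight γ).tsum_eq fun x => ‖f x‖ ^ (2 : ℝ≥0∞).toReal
    have h5 := h1.trans (h4.trans h3.symm)
    have h6 : (2 : ℝ≥0∞).toReal = (2:ℝ) := by norm_num
    rw [h6] at h5
    have h7 : ∀ a : ℝ, 0 ≤ a → Real.sqrt (a ^ (2:ℝ)) = a := by
      intro a ha
      rw [show ((2:ℝ)) = ((2:ℕ):ℝ) by norm_num, Real.rpow_natCast]
      exact Real.sqrt_sq ha
    calc ‖(⟨fun x => f (x * γ), translate_memℓp γ f⟩ : l2 Γ)‖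
        = Real.sqrt (‖(⟨fun x => f (x * γ), translate_memℓp γ f⟩ : l2 Γ)‖ ^ (2:ℝ)) :=
          (h7 _ (norm_nonneg _)).symm
      _ = Real.sqrt (‖f‖ ^ (2:ℝ)) := by rw [h5]
      _ = ‖f‖ := h7 _ (norm_nonneg _)

/-- The right-translation unitary as a bounded operator on `ℓ²(Γ)`. -/
def rho (γ : Γ) : l2 Γ →L[ℂ] l2 Γ :=
  ((rhoEquiv γ).toContinuousLinearEquiv : l2 Γ ≃L[ℂ] l2 Γ).toContinuousLinearMap

/-- For `a = Σ_γ a(γ)γ ∈ ℤΓ`, the operator `R_a := Σ_γ a(γ) ρ_γ` on `ℓ²(Γ)`. -/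
def Rop (a : MonoidAlgebra ℤ Γ) : l2 Γ →L[ℂ] l2 Γ :=
  a.coeff.sum fun γ k => (k : ℂ) • rho γ

/-- `ℓ²(Γ)ⁿ`, indexed by a finite type `ι`. -/
abbrev Hn (Γ : Type) [Group Γ] (ι : Type) [Fintype ι] : Type :=
  PiLp 2 fun _ : ι => l2 Γ

def projL (Γ : Type) [Group Γ] {ι : Type} [Fintype ι] (j : ι) : Hn Γ ι →L[ℂ] l2 Γ :=
  (ContinuousLinearMap.proj j).comp
    (PiLp.continuousLinearEquiv 2 ℂ (fun _ : ι => l2 Γ)).toContinuousLinearMap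

def inclL (Γ : Type) [Group Γ] {ι : Type} [Fintype ι] [DecidableEq ι] (i : ι) :
    l2 Γ →L[ℂ] Hn Γ ι :=
  ((PiLp.continuousLinearEquiv 2 ℂ (fun _ : ι => l2 Γ)).symm.toContinuousLinearMap).comp
    { toLinearMap := LinearMap.single ℂ (fun _ : ι => l2 Γ) i
      cont := by
        show Continuous fun x : l2 Γ => (LinearMap.single ℂ (fun _ : ι => l2 Γ) i) x
        refine continuous_pi fun j => ?_
        show Continuous fun x : l2 Γ => (LinearMap.single ℂ (fun _ : ι => l2 Γ) i) x j
        by_cases h : j = i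
        · subst h
          have hfun : (fun x : l2 Γ => (LinearMap.single ℂ (fun _ : ι => l2 Γ) j) x j)
              = fun x => x := by funext x; simp
          rw [hfun]; exact continuous_id
        · have hfun : (fun x : l2 Γ => (LinearMap.single ℂ (fun _ : ι => l2 Γ) i) x j)
              = fun _ => 0 := by funext x; simp [Pi.single_eq_of_ne h]
          rw [hfun]; exact continuous_const }

/-- For a matrix `A = (a_{ij})` over `ℤΓ`, the bounded operator `R_A` on `ℓ²(Γ)ⁿ`
whose `(i,j)` entry is `R_{a_{ij}}`. -/
def RA {ι κ : Type} [Fintype ι] [Fintype κ] (A : Matrix ι κ (MonoidAlgebra ℤ Γ)) :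
    Hn Γ κ →L[ℂ] Hn Γ ι :=
  letI := Classical.decEq ι
  ∑ i, ∑ j, (inclL Γ i).comp ((Rop (A i j)).comp (projL Γ j))

/-- The vector `δ_e ⊗ e_i ∈ ℓ²(Γ)ⁿ`. -/
def deltaE (Γ : Type) [Group Γ] {ι : Type} [Fintype ι] (i : ι) : Hn Γ ι :=
  letI := Classical.decEq ι
  letI := Classical.decEq Γ
  (PiLp.continuousLinearEquiv 2 ℂ (fun _ : ι => l2 Γ)).symm
    (Pi.single i (lp.single 2 (1 : Γ) 1))

/-- The von Neumann trace `τ(T) := Σ_i ⟨T(δ_e ⊗ e_i), δ_e ⊗ e_i⟩`. -/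
def vnTrace {ι : Type} [Fintype ι] (T : Hn Γ ι →L[ℂ] Hn Γ ι) : ℂ :=
  ∑ i, inner (𝕜 := ℂ) (T (deltaE Γ i)) (deltaE Γ i)

theorem cfc_real_of_hilbert {H : Type} [NormedAddCommGroup H] [InnerProductSpace ℂ H]
    [CompleteSpace H] : ContinuousFunctionalCalculus ℝ (H →L[ℂ] H) IsSelfAdjoint :=
  inferInstance

instance Hn.instContinuousFunctionalCalculus {ι : Type} [Fintype ι] :
    ContinuousFunctionalCalculus ℝ (Hn Γ ι →L[ℂ] Hn Γ ι) IsSelfAdjoint :=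
  cfc_real_of_hilbert (H := Hn Γ ι)

/-- The Fuglede–Kadison determinant
`Det_τ(T) := exp(½ Re τ(log (T*T)))`, where `log(T*T)` is given by the continuous
functional calculus. -/
def FKdet {ι : Type} [Fintype ι] (T : Hn Γ ι →L[ℂ] Hn Γ ι) : ℝ :=
  Real.exp ((1 / 2) * (vnTrace (cfc Real.log (star T * T))).re)

/-- `Γ` is amenable: there is a left-invariant mean on the space of bounded real-valued
functions on `Γ`, i.e. a positive linear functional `m` with `m(1) = 1` and
`m(f(γ⁻¹ ·)) = m(f)` for all `γ` and bounded `f`.  (We give `Γ` the discrete topology, so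
that bounded continuous functions are exactly the bounded functions.) -/
def IsAmenable (Γ : Type) [Group Γ] : Prop :=
  letI : TopologicalSpace Γ := ⊥
  haveI : DiscreteTopology Γ := ⟨rfl⟩
  ∃ m : BoundedContinuousFunction Γ ℝ →ₗ[ℝ] ℝ,
    (∀ f : BoundedContinuousFunction Γ ℝ, (∀ x, 0 ≤ f x) → 0 ≤ m f) ∧
    m 1 = 1 ∧
    ∀ (γ : Γ) (f : BoundedContinuousFunction Γ ℝ),
      m (f.compContinuous ⟨fun x => γ⁻¹ * x, continuous_of_discreteTopology⟩) = m f

/-- `Γ` is finitely presented. -/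
def IsFinitelyPresented (Γ : Type) [Group Γ] : Prop :=
  ∃ (n : ℕ) (rels : Set (FreeGroup (Fin n))),
    rels.Finite ∧ Nonempty (PresentedGroup rels ≃* Γ)

/-- `Γ` is residually finite: every nontrivial element is detected by a homomorphism to a
finite group. -/
def IsResiduallyFinite (Γ : Type) [Group Γ] : Prop :=
  ∀ γ : Γ, γ ≠ 1 → ∃ (G : Type) (_ : Group G) (_ : Finite G) (φ : Γ →* G), φ γ ≠ 1

open scoped Pointwise in
theorem aux_mean (ham : IsAmenable Γ) : ∃ μ : Set Γ → ℝ, (∀ A, 0 ≤ μ A) ∧ μ Set.univ = 1 ∧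
    (∀ A B, Disjoint A B → μ (A ∪ B) = μ A + μ B) ∧
    ∀ (g : Γ) (A : Set Γ), μ ((fun x => g * x) '' A) = μ A := by
  classical
  unfold IsAmenable at ham
  letI : TopologicalSpace Γ := ⊥
  haveI : DiscreteTopology Γ := ⟨rfl⟩
  obtain ⟨m, hpos, hone, hinv⟩ := ham
  let ind : Set Γ → BoundedContinuousFunction Γ ℝ := fun A =>
    BoundedContinuousFunction.ofNormedAddCommGroupDiscrete (A.indicator (fun _ => (1:ℝ))) 1
      (by intro x; by_cases h : x ∈ A <;> simp [h])
  have hind : ∀ A x, ind A x = A.indicator (fun _ => (1:ℝ)) x := fun A x => rfl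
  refine ⟨fun A => m (ind A), ?_, ?_, ?_, ?_⟩
  · intro A
    apply hpos
    intro x
    rw [hind]
    exact Set.indicator_nonneg (fun _ _ => zero_le_one) x
  · rw [← hone]
    refine congrArg m ?_
    ext x
    simp [hind]
  · intro A B h
    rw [← map_add]
    refine congrArg m ?_
    ext x
    rw [BoundedContinuousFunction.add_apply, hind, hind, hind, Set.indicator_union_of_disjoint h]
  · intro g A
    show m (ind _) = m (ind A)
    rw [← hinv g (ind A)]
    congr 1
    ext x
    rw [BoundedContinuousFunction.compContinuous_apply, hind, hind]
    have : x ∈ ((fun x => g * x) '' A) ↔ g⁻¹ * x ∈ A := by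
      constructor
      · rintro ⟨y, hy, rfl⟩; simpa using hy
      · intro h; exact ⟨_, h, by simp⟩
    by_cases h : g⁻¹ * x ∈ A
    · simp only [ContinuousMap.coe_mk]
      rw [Set.indicator_of_mem h, Set.indicator_of_mem (this.2 h)]
    · simp only [ContinuousMap.coe_mk]
      rw [Set.indicator_of_notMem h, Set.indicator_of_notMem (fun h' => h (this.1 h'))]

theorem aux_no_paradox (ham : IsAmenable Γ) (K : Finset Γ) (f : Γ × Bool → Γ)
    (hf : Function.Injective f) (hK : ∀ z, ∃ g ∈ K, f z = g * z.1) : False := by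
  classical
  obtain ⟨μ, hpos, hone, hadd, hinv⟩ := aux_mean ham
  have hempty : μ ∅ = 0 := by
    have := hadd ∅ ∅ (by simp)
    simp at this
    exact this
  have hsum : ∀ (S : Finset Γ) (A : Γ → Set Γ), (∀ i j, i ≠ j → Disjoint (A i) (A j)) →
      μ (⋃ g ∈ S, A g) = ∑ g ∈ S, μ (A g) := by
    intro S A hA
    induction S using Finset.induction_on with
    | empty => simp [hempty]
    | insert a S ha ih =>
      rw [Finset.set_biUnion_insert, hadd, ih, Finset.sum_insert ha]
      rw [Set.disjoint_iUnion₂_right]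
      intro i hi
      exact hA _ _ (fun h => ha (h ▸ hi))
  have hr : ∀ b, μ (Set.range fun x => f (x, b)) = 1 := by
    intro b
    have h1 := hsum K (fun g => {x | f (x, b) = g * x}) (by
      intro i j hij
      rw [Set.disjoint_left]
      intro x hx hx'
      simp only [Set.mem_ofPred_eq] at hx hx'
      exact hij (mul_right_cancel (hx.symm.trans hx')))
    have h2 := hsum K (fun g => (fun x => g * x) '' {x | f (x, b) = g * x}) (by
      intro i j hij
      rw [Set.disjoint_left]
      rintro _ ⟨x, hx, rfl⟩ ⟨y, hy, hxy⟩
      simp only [Set.mem_ofPred_eq] at hx hy hxy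
      have : f (x, b) = f (y, b) := by rw [hx, hy, hxy]
      have h3 := hf this
      simp only [Prod.mk.injEq, and_true] at h3
      subst h3
      exact hij (mul_right_cancel hxy).symm)
    simp only [hinv] at h2
    rw [← h1] at h2
    have h3 : (⋃ g ∈ K, {x | f (x, b) = g * x}) = Set.univ := by
      ext x
      simp only [Set.mem_iUnion, Set.mem_ofPred_eq, exists_prop, Set.mem_univ, iff_true]
      exact hK (x, b)
    have h4 : (⋃ g ∈ K, (fun x => g * x) '' {x | f (x, b) = g * x}) =
        Set.range fun x => f (x, b) := by
      ext y
      simp only [Set.mem_iUnion, Set.mem_image, Set.mem_ofPred_eq, exists_prop, Set.mem_range]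
      constructor
      · rintro ⟨g, hg, x, hx, rfl⟩; exact ⟨x, hx⟩
      · rintro ⟨x, rfl⟩
        obtain ⟨g, hg, h⟩ := hK (x, b)
        exact ⟨g, hg, x, h, h.symm⟩
    rw [h3, h4, hone] at h2
    exact h2
  have h5 := hadd (Set.range fun x => f (x, true)) (Set.range fun x => f (x, false)) (by
    rw [Set.disjoint_left]
    rintro _ ⟨x, rfl⟩ ⟨y, hy⟩
    have := hf hy
    simp at this)
  rw [hr, hr] at h5
  have h6 := hadd _ _ (disjoint_compl_right
    (a := (Set.range fun x => f (x, true)) ∪ (Set.range fun x => f (x, false))))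
  rw [Set.union_compl_self, hone, h5] at h6
  have := hpos (((Set.range fun x => f (x, true)) ∪ (Set.range fun x => f (x, false)))ᶜ)
  linarith

open scoped Pointwise in
theorem aux_folner_left (ham : IsAmenable Γ) [DecidableEq Γ] (K : Finset Γ)
    (η : ℝ) (hη : 0 < η) :
    ∃ F : Finset Γ, F.Nonempty ∧ ((K * F).card : ℝ) ≤ (1 + η) * F.card := by
  by_contra! hcon
  have hpow : ∀ (k : ℕ) (F : Finset Γ), (1 + η) ^ k * (F.card : ℝ) ≤ ((K ^ k * F).card : ℝ) := by
    intro k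
    induction k with
    | zero => intro F; simp
    | succ k ih =>
      intro F
      rcases F.eq_empty_or_nonempty with rfl | hF
      · simp
      · have h1 := hcon F hF
        have h2 := ih (K * F)
        rw [pow_succ K, mul_assoc, pow_succ]
        refine le_trans ?_ h2
        rw [mul_assoc]
        exact mul_le_mul_of_nonneg_left h1.le (by positivity)
  obtain ⟨k, hk⟩ := pow_unbounded_of_one_lt 2 (show 1 < 1 + η by linarith)
  have hall := (Finset.all_card_le_biUnion_card_iff_exists_injective
    (fun z : Γ × Bool => K ^ k * {z.1})).1 (by
      intro s
      have h1 : s.card ≤ 2 * (s.image Prod.fst).card := by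
        have : s ⊆ (s.image Prod.fst) ×ˢ (Finset.univ : Finset Bool) := by
          intro z hz
          simp only [Finset.mem_product, Finset.mem_univ, and_true]
          exact Finset.mem_image_of_mem _ hz
        have := Finset.card_le_card this
        rw [Finset.card_product] at this
        simp at this
        omega
      have h2 : s.biUnion (fun z : Γ × Bool => K ^ k * {z.1}) = K ^ k * s.image Prod.fst := by
        ext y
        simp only [Finset.mem_biUnion, Finset.mem_mul, Finset.mem_singleton, Finset.mem_image]
        constructor
        · rintro ⟨z, hz, g, hg, w, rfl, h⟩
          exact ⟨g, hg, z.1, ⟨z, hz, rfl⟩, h⟩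
        · rintro ⟨g, hg, w, ⟨z, hz, rfl⟩, h⟩
          exact ⟨z, hz, g, hg, z.1, rfl, h⟩
      rw [h2]
      have h3 := hpow k (s.image Prod.fst)
      have h4 : (s.card : ℝ) ≤ ((K ^ k * s.image Prod.fst).card : ℝ) := by
        have h1' : (s.card : ℝ) ≤ 2 * ((s.image Prod.fst).card : ℝ) := by exact_mod_cast h1
        have : 2 * ((s.image Prod.fst).card : ℝ) ≤ (1 + η) ^ k * ((s.image Prod.fst).card : ℝ) :=
          mul_le_mul_of_nonneg_right hk.le (Nat.cast_nonneg _)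
        linarith
      exact_mod_cast h4)
  obtain ⟨f, hf, hfK⟩ := hall
  refine aux_no_paradox ham (K ^ k) f hf ?_
  intro z
  have := hfK z
  simp only [Finset.mem_mul, Finset.mem_singleton] at this
  obtain ⟨g, hg, w, rfl, h⟩ := this
  exact ⟨g, hg, h.symm⟩

open scoped Pointwise in
theorem aux_folner (ham : IsAmenable Γ) [DecidableEq Γ] (K : Finset Γ)
    (η : ℝ) (hη : 0 < η) :
    ∃ F : Finset Γ, F.Nonempty ∧
      ((F.filter fun x => ∃ k ∈ K, x * k ∉ F).card : ℝ) ≤ η * F.card := by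
  let K' : Finset Γ := insert 1 K⁻¹
  have hK0 : (0:ℝ) < K.card + 1 := by positivity
  obtain ⟨F, hF, hc⟩ := aux_folner_left ham K' (η / (K.card + 1)) (by positivity)
  refine ⟨F⁻¹, hF.inv, ?_⟩
  have hsub : F ⊆ K' * F := by
    intro x hx
    exact Finset.mem_mul.2 ⟨1, by simp [K'], x, hx, by simp⟩
  have hd : (((K' * F) \ F).card : ℝ) ≤ η / (K.card + 1) * F.card := by
    rw [Finset.card_sdiff_of_subset hsub, Nat.cast_sub (Finset.card_le_card hsub)]
    linarith
  have hb : (F⁻¹.filter fun x => ∃ k ∈ K, x * k ∉ F⁻¹).card ≤ K.card * ((K' * F) \ F).card := by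
    have : (F⁻¹.filter fun x => ∃ k ∈ K, x * k ∉ F⁻¹) ⊆
        K.biUnion fun k => ((K' * F) \ F).image fun y => y⁻¹ * k⁻¹ := by
      intro x hx
      rw [Finset.mem_filter] at hx
      obtain ⟨hxF, k, hk, hn⟩ := hx
      rw [Finset.mem_biUnion]
      refine ⟨k, hk, ?_⟩
      rw [Finset.mem_image]
      refine ⟨k⁻¹ * x⁻¹, ?_, by group⟩
      rw [Finset.mem_sdiff]
      constructor
      · exact Finset.mul_mem_mul (by simp [K', hk]) (by simpa using hxF)
      · intro h
        apply hn
        rw [Finset.mem_inv']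
        simpa using h
    refine (Finset.card_le_card this).trans ?_
    refine Finset.card_biUnion_le_card_mul _ _ _ ?_
    intro k _
    exact Finset.card_image_le
  rw [Finset.card_inv]
  have hb' : ((F⁻¹.filter fun x => ∃ k ∈ K, x * k ∉ F⁻¹).card : ℝ) ≤
      K.card * ((K' * F) \ F).card := by exact_mod_cast hb
  refine hb'.trans ?_
  calc (K.card : ℝ) * ((K' * F) \ F).card ≤ K.card * (η / (K.card + 1) * F.card) := by gcongr
    _ = (K.card / (K.card + 1)) * (η * F.card) := by ring
    _ ≤ 1 * (η * F.card) := by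
      gcongr
      rw [div_le_one hK0]
      linarith
    _ = _ := one_mul _

theorem aux_matrix {κ : Type} [Fintype κ] [DecidableEq κ] (A : Matrix κ κ ℂ)
    (hA : A.IsHermitian) : ∃ (lam : κ → ℝ) (q : κ → κ → ℝ), (∀ z i, 0 ≤ q z i) ∧
    (∀ i, ∑ z, q z i = 1) ∧ (∀ z, ∑ i, q z i = 1) ∧
    (∀ (p : Polynomial ℝ) z, (Polynomial.aeval A p) z z
      = ((∑ i, q z i * p.eval (lam i) : ℝ) : ℂ)) ∧
    A.det = ((∏ i, lam i : ℝ) : ℂ) ∧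
    ∀ i, ∃ v : κ → ℂ, ∑ z, ‖v z‖ ^ 2 = 1 ∧ lam i = (star v ⬝ᵥ A.mulVec v).re := by
  set U : Matrix κ κ ℂ := (hA.eigenvectorUnitary : Matrix κ κ ℂ) with hU
  have hU1 : star U * U = 1 := Unitary.coe_star_mul_self hA.eigenvectorUnitary
  have hU2 : U * star U = 1 := Unitary.coe_mul_star_self hA.eigenvectorUnitary
  have hn : ∀ a : ℂ, a * star a = ((‖a‖ ^ 2 : ℝ) : ℂ) := by
    intro a
    rw [Complex.star_def, Complex.mul_conj, Complex.normSq_eq_norm_sq]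
  refine ⟨hA.eigenvalues, fun z i => ‖U z i‖ ^ 2, fun z i => by positivity, ?_, ?_, ?_, ?_, ?_⟩
  · intro i
    have := congrFun (congrFun hU1 i) i
    rw [Matrix.mul_apply] at this
    simp only [Matrix.star_apply, Matrix.one_apply_eq] at this
    have h2 : ((∑ z, ‖U z i‖ ^ 2 : ℝ) : ℂ) = 1 := by
      rw [← this, Complex.ofReal_sum]
      refine Finset.sum_congr rfl fun z _ => ?_
      rw [← hn, mul_comm]
    exact_mod_cast h2
  · intro z
    have := congrFun (congrFun hU2 z) z
    rw [Matrix.mul_apply] at this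
    simp only [Matrix.star_apply, Matrix.one_apply_eq] at this
    have h2 : ((∑ i, ‖U z i‖ ^ 2 : ℝ) : ℂ) = 1 := by
      rw [← this, Complex.ofReal_sum]
      refine Finset.sum_congr rfl fun i _ => ?_
      rw [← hn]
    exact_mod_cast h2
  · intro p z
    rw [← cfc_polynomial p A hA.isSelfAdjoint, hA.cfc_eq, Matrix.IsHermitian.cfc,
      Unitary.conjStarAlgAut_apply, Matrix.mul_apply, Complex.ofReal_sum]
    refine Finset.sum_congr rfl fun i _ => ?_
    rw [Matrix.mul_diagonal, Complex.ofReal_mul, ← hn]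
    simp only [Function.comp, Matrix.star_apply, ← hU]
    simp
    ring
  · rw [hA.det_eq_prod_eigenvalues]
    simp
  · intro i
    refine ⟨⇑(hA.eigenvectorBasis i), ?_, ?_⟩
    · rw [← EuclideanSpace.norm_sq_eq, hA.eigenvectorBasis.norm_eq_one]
      simp
    · exact hA.eigenvalues_eq i

theorem aux_pow_succ {H : Type} [NormedAddCommGroup H] [InnerProductSpace ℂ H]
    (M : H →L[ℂ] H) (k : ℕ) (v : H) : (M ^ (k + 1)) v = M ((M ^ k) v) := by
  rw [pow_succ']; rfl

theorem aux_span {Z H : Type} [NormedAddCommGroup H] [InnerProductSpace ℂ H]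
    (b : Z → H) (hb : Orthonormal ℂ b) (F : Finset Z) (v : H)
    (hv : v ∈ Submodule.span ℂ (b '' (F : Set Z))) :
    v = ∑ z : F, (inner ℂ (b z) v : ℂ) • b z := by
  classical
  induction hv using Submodule.span_induction with
  | mem x hx =>
    obtain ⟨w, hw, rfl⟩ := hx
    rw [Finset.sum_eq_single (⟨w, hw⟩ : F)]
    · simp [inner_self_eq_norm_sq_to_K, hb.1 w]
    · intro z _ hz
      rw [hb.2 (fun h => hz (Subtype.ext h)), zero_smul]
    · simp
  | zero => simp
  | add x y _ _ hx hy =>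
    simp only [inner_add_right, add_smul, Finset.sum_add_distrib]
    rw [← hx, ← hy]
  | smul a x _ hx =>
    simp only [inner_smul_right, mul_smul]
    rw [← Finset.smul_sum, ← hx]

theorem aux_compress {Z H : Type} [DecidableEq Z] [NormedAddCommGroup H] [InnerProductSpace ℂ H]
    (b : Z → H) (hb : Orthonormal ℂ b) (M : H →L[ℂ] H) (F : Finset Z)
    (MF : Matrix F F ℂ) (hMF : ∀ z w, MF z w = inner ℂ (b z) (M (b w))) (w : F) (d : ℕ)
    (hd : ∀ k ≤ d, (M ^ k) (b w) ∈ Submodule.span ℂ (b '' (F : Set Z)))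
    (p : Polynomial ℝ) (hp : p.natDegree ≤ d) :
    (inner ℂ (b w) ((Polynomial.aeval M p) (b w)) : ℂ) = (Polynomial.aeval MF p) w w := by
  have hk : ∀ k ≤ d, (M ^ k) (b w) = ∑ z : F, (MF ^ k) z w • b z := by
    intro k
    induction k with
    | zero =>
      intro _
      simp [Matrix.one_apply]
    | succ k ih =>
      intro hkd
      have h1 := aux_span b hb F _ (hd (k + 1) hkd)
      rw [h1]
      refine Finset.sum_congr rfl fun z _ => ?_
      congr 1
      rw [aux_pow_succ, ih (by omega), map_sum, inner_sum,
        pow_succ', Matrix.mul_apply]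
      refine Finset.sum_congr rfl fun y _ => ?_
      rw [map_smul, inner_smul_right, hMF, mul_comm]
  have hin : ∀ k ≤ d, (inner ℂ (b w) ((M ^ k) (b w)) : ℂ) = (MF ^ k) w w := by
    intro k hkd
    rw [hk k hkd, inner_sum, Finset.sum_eq_single w]
    · rw [inner_smul_right]
      simp [inner_self_eq_norm_sq_to_K, hb.1 w]
    · intro z _ hz
      rw [inner_smul_right, hb.2 (fun h => hz (Subtype.ext h.symm)), mul_zero]
    · simp
  rw [Polynomial.aeval_eq_sum_range, Polynomial.aeval_eq_sum_range,
    sum_apply, inner_sum, Matrix.sum_apply]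
  refine Finset.sum_congr rfl fun k hk' => ?_
  rw [Finset.mem_range] at hk'
  rw [Matrix.smul_apply, ← hin k (by omega), smul_apply,
    inner_smul_right_eq_smul]

open scoped Pointwise in
theorem aux_local {ι H : Type} [DecidableEq Γ] [NormedAddCommGroup H] [InnerProductSpace ℂ H]
    (b : Γ × ι → H) (M : H →L[ℂ] H) (S : Finset Γ)
    (hloc : ∀ x i, M (b (x, i)) ∈ Submodule.span ℂ (b '' {z | x⁻¹ * z.1 ∈ S})) (k : ℕ) :
    ∀ x i, (M ^ k) (b (x, i)) ∈ Submodule.span ℂ (b '' {z | x⁻¹ * z.1 ∈ S ^ k}) := by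
  induction k with
  | zero =>
    intro x i
    exact Submodule.subset_span ⟨(x, i), by simp, by simp⟩
  | succ k ih =>
    intro x i
    rw [aux_pow_succ]
    have h := ih x i
    generalize (M ^ k) (b (x, i)) = v at h
    induction h using Submodule.span_induction with
    | mem v hv =>
      obtain ⟨⟨y, j⟩, hy, rfl⟩ := hv
      refine Submodule.span_mono (Set.image_mono ?_) (hloc y j)
      rintro ⟨u, l⟩ hu
      simp only [Set.mem_ofPred_eq] at hu hy ⊢
      rw [pow_succ]
      exact Finset.mem_mul.2 ⟨_, hy, _, hu, by group⟩
    | zero => simp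
    | add v w _ _ hv hw => rw [map_add]; exact Submodule.add_mem _ hv hw
    | smul a v _ hv => rw [map_smul]; exact Submodule.smul_mem _ _ hv

theorem aux_spec {H : Type} [NormedAddCommGroup H] [InnerProductSpace ℂ H] [CompleteSpace H]
    (M : H →L[ℂ] H) (hsa : IsSelfAdjoint M) (c C : ℝ)
    (hlo : ∀ v, c * ‖v‖ ^ 2 ≤ (inner ℂ v (M v) : ℂ).re)
    (hhi : ∀ v, (inner ℂ v (M v) : ℂ).re ≤ C * ‖v‖ ^ 2) :
    ∀ x ∈ spectrum ℝ M, c ≤ x ∧ x ≤ C := by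
  have key : ∀ (r : ℝ) v, (inner ℂ v ((algebraMap ℝ (H →L[ℂ] H) r) v) : ℂ).re = r * ‖v‖ ^ 2 := by
    intro r v
    rw [Algebra.algebraMap_eq_smul_one, smul_apply,
      one_apply_eq_self, inner_smul_right_eq_smul, Complex.smul_re]
    rw [inner_self_eq_norm_sq_to_K]
    norm_cast
  have hsa' : ∀ r : ℝ, IsSelfAdjoint (algebraMap ℝ (H →L[ℂ] H) r) := fun r =>
    IsSelfAdjoint.algebraMap _ (IsSelfAdjoint.all r)
  intro x hx
  constructor
  · have h : algebraMap ℝ (H →L[ℂ] H) c ≤ M := by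
      rw [ContinuousLinearMap.le_def, ContinuousLinearMap.isPositive_def']
      refine ⟨hsa.sub (hsa' c), fun v => ?_⟩
      rw [ContinuousLinearMap.reApplyInnerSelf_apply, inner_re_symm, sub_apply,
        inner_sub_right, map_sub]
      have h1 := hlo v
      have h2 := key c v
      show 0 ≤ (inner ℂ v (M v) : ℂ).re - (inner ℂ v ((algebraMap ℝ (H →L[ℂ] H) c) v) : ℂ).re
      linarith
    exact (algebraMap_le_iff_le_spectrum hsa).1 h x hx
  · have h : M ≤ algebraMap ℝ (H →L[ℂ] H) C := by
      rw [ContinuousLinearMap.le_def, ContinuousLinearMap.isPositive_def']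
      refine ⟨(hsa' C).sub hsa, fun v => ?_⟩
      rw [ContinuousLinearMap.reApplyInnerSelf_apply, inner_re_symm, sub_apply,
        inner_sub_right, map_sub]
      have h1 := hhi v
      have h2 := key C v
      show 0 ≤ (inner ℂ v ((algebraMap ℝ (H →L[ℂ] H) C) v) : ℂ).re - (inner ℂ v (M v) : ℂ).re
      linarith
    exact (le_algebraMap_iff_spectrum_le hsa).1 h x hx

open scoped Pointwise in
theorem aux_poly (ham : IsAmenable Γ) {ι H : Type} [Fintype ι]
    [DecidableEq ι] [DecidableEq Γ]
    [NormedAddCommGroup H] [InnerProductSpace ℂ H] [CompleteSpace H]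
    (b : Γ × ι → H) (hb : Orthonormal ℂ b) (M : H →L[ℂ] H) (hsa : IsSelfAdjoint M)
    (c C : ℝ) (hc : 0 < c)
    (hlo : ∀ v, c * ‖v‖ ^ 2 ≤ (inner ℂ v (M v) : ℂ).re)
    (hhi : ∀ v, (inner ℂ v (M v) : ℂ).re ≤ C * ‖v‖ ^ 2)
    (S : Finset Γ)
    (hloc : ∀ x i, M (b (x, i)) ∈ Submodule.span ℂ (b '' {z | x⁻¹ * z.1 ∈ S}))
    (hint : ∀ z w, ∃ k : ℤ, (inner ℂ (b z) (M (b w)) : ℂ) = k)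
    (U : Γ → H ≃ₗᵢ[ℂ] H) (hU : ∀ g i, U g (b (1, i)) = b (g, i))
    (hUM : ∀ g v, U g (M v) = M (U g v))
    (p : Polynomial ℝ) (ε : ℝ) (hp : ∀ x ∈ Set.Icc c C, |p.eval x - Real.log x| ≤ ε) :
    0 ≤ ∑ i, (inner ℂ (b (1, i)) ((Polynomial.aeval M p) (b (1, i))) : ℂ).re
      + ε * Fintype.card ι := by
  have hUpow : ∀ (k : ℕ) g v, U g ((M ^ k) v) = (M ^ k) (U g v) := by
    intro k
    induction k with
    | zero => intro g v; simp
    | succ k ih => intro g v; rw [aux_pow_succ, aux_pow_succ, hUM, ih]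
  have hUp : ∀ g v, U g ((Polynomial.aeval M p) v) = (Polynomial.aeval M p) (U g v) := by
    intro g v
    rw [Polynomial.aeval_eq_sum_range, sum_apply, sum_apply, map_sum]
    refine Finset.sum_congr rfl fun k _ => ?_
    rw [smul_apply, smul_apply, ← hUpow]
    exact ((U g).toLinearEquiv.toLinearMap.restrictScalars ℝ).map_smul _ _
  set t : ι → ℝ := fun i => (inner ℂ (b (1, i)) ((Polynomial.aeval M p) (b (1, i))) : ℂ).re
    with ht
  have htx : ∀ x i, (inner ℂ (b (x, i)) ((Polynomial.aeval M p) (b (x, i))) : ℂ).re = t i := by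
    intro x i
    rw [← hU x i, ← hUp, LinearIsometryEquiv.inner_map_map]
  obtain ⟨L, hL⟩ := isCompact_Icc.exists_bound_of_continuousOn
    (s := Set.Icc c C) (f := fun x => p.eval x) p.continuous.continuousOn
  set n : ℝ := (Fintype.card ι : ℝ) with hn
  set Q : ℝ := ∑ i, (|t i| + L) with hQ
  have claim : ∀ η > 0, 0 ≤ ∑ i, t i + ε * n + η * Q := by
    intro η hη
    set d := p.natDegree
    set K : Finset Γ := (insert 1 S) ^ d with hK
    obtain ⟨F, hF, hbd⟩ := aux_folner ham K η hη
    set bd : Finset Γ := F.filter fun x => ∃ k ∈ K, x * k ∉ F with hbddef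
    set F' : Finset (Γ × ι) := F ×ˢ Finset.univ with hF'
    let MF : Matrix F' F' ℂ := fun z w => inner ℂ (b z) (M (b w))
    have hMF : ∀ z w, MF z w = inner ℂ (b z) (M (b w)) := fun _ _ => rfl
    have hherm : MF.IsHermitian := by
      ext z w
      rw [Matrix.conjTranspose_apply, hMF, hMF, Complex.star_def, inner_conj_symm]
      conv_lhs => rw [← hsa.adjoint_eq]
      rw [ContinuousLinearMap.adjoint_inner_left]
    obtain ⟨lam, q, hq0, hq1, hq2, hdiag, hdet, hray⟩ := aux_matrix MF hherm
    have hlam : ∀ i, lam i ∈ Set.Icc c C := by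
      intro i
      obtain ⟨v, hv, hl⟩ := hray i
      set J : H := ∑ z : F', v z • b z with hJ
      have hb' : Orthonormal ℂ (fun z : F' => b z) := hb.comp _ Subtype.val_injective
      have h1 : ‖J‖ ^ 2 = 1 := by
        have h : (inner ℂ J J : ℂ) = ((∑ z, ‖v z‖ ^ 2 : ℝ) : ℂ) := by
          rw [hJ, hb'.inner_sum, Complex.ofReal_sum]
          refine Finset.sum_congr rfl fun z _ => ?_
          rw [Complex.conj_mul']
          push_cast; rfl
        rw [@norm_sq_eq_re_inner ℂ, h, hv]
        simp
      have h2 : (inner ℂ J (M J) : ℂ) = star v ⬝ᵥ MF.mulVec v := by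
        rw [hJ, map_sum, sum_inner, dotProduct]
        refine Finset.sum_congr rfl fun z _ => ?_
        rw [inner_smul_left, inner_sum, Matrix.mulVec, dotProduct]
        congr 1
        refine Finset.sum_congr rfl fun w _ => ?_
        rw [map_smul, inner_smul_right, hMF, mul_comm]
      rw [hl, ← h2]
      have h3 := hlo J
      have h4 := hhi J
      rw [h1] at h3 h4
      constructor <;> linarith
    have hlog : 0 ≤ ∑ i, Real.log (lam i) := by
      rw [← Real.log_prod (fun i _ => (lt_of_lt_of_le hc (hlam i).1).ne')]
      apply Real.log_nonneg
      choose ki hki using hint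
      have h1 : MF = (Matrix.of fun z w : F' => ki z w).map (Int.castRingHom ℂ) := by
        ext z w
        rw [hMF, hki]
        simp
      have h2 : MF.det = (((Matrix.of fun z w : F' => ki z w).det : ℤ) : ℂ) := by
        rw [h1, ← RingHom.mapMatrix_apply, ← RingHom.map_det]
        simp
      rw [hdet] at h2
      have h3 : (∏ i, lam i) = (((Matrix.of fun z w : F' => ki z w).det : ℤ) : ℝ) := by
        apply Complex.ofReal_injective
        rw [h2, Complex.ofReal_intCast]
      have h4 : 0 < ∏ i, lam i := Finset.prod_pos fun i _ => lt_of_lt_of_le hc (hlam i).1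
      rw [h3] at h4 ⊢
      have h5 : 0 < (Matrix.of fun z w : F' => ki z w).det := by exact_mod_cast h4
      exact_mod_cast h5
    set D : F' → ℝ := fun w => ∑ i, q w i * p.eval (lam i) with hD
    have hDsum : ∑ w, D w = ∑ i, p.eval (lam i) := by
      simp only [hD]
      rw [Finset.sum_comm]
      refine Finset.sum_congr rfl fun i _ => ?_
      rw [← Finset.sum_mul, hq1, one_mul]
    have hcardF' : (Fintype.card F' : ℝ) = F.card * n := by
      rw [Fintype.card_coe, hF', Finset.card_product, Nat.cast_mul, hn, Finset.card_univ]
    have hDlow : -(ε * (F.card * n)) ≤ ∑ w, D w := by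
      rw [hDsum]
      have : ∑ i, (Real.log (lam i) - ε) ≤ ∑ i, p.eval (lam i) := by
        refine Finset.sum_le_sum fun i _ => ?_
        have := abs_le.1 (hp _ (hlam i))
        linarith [this.1]
      rw [Finset.sum_sub_distrib, Finset.sum_const, Finset.card_univ, nsmul_eq_mul, hcardF'] at this
      linarith
    have hDL : ∀ w, D w ≤ L := by
      intro w
      calc D w ≤ ∑ i, q w i * L := by
            refine Finset.sum_le_sum fun i _ => ?_
            refine mul_le_mul_of_nonneg_left ?_ (hq0 _ _)
            exact (le_abs_self _).trans (hL _ (hlam i))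
        _ = L := by rw [← Finset.sum_mul, hq2, one_mul]
    have hDint : ∀ w : F', (w : Γ × ι).1 ∉ bd → D w = t (w : Γ × ι).2 := by
      rintro ⟨⟨x, i⟩, hw⟩ hx
      have hxF : x ∈ F := (Finset.mem_product.1 hw).1
      have hxK : ∀ k ∈ K, x * k ∈ F := by
        intro k hk
        by_contra h
        exact hx (Finset.mem_filter.2 ⟨hxF, k, hk, h⟩)
      have h1 := aux_compress b hb M F' MF hMF ⟨(x, i), hw⟩ d (by
        intro k hk
        refine Submodule.span_mono (Set.image_mono ?_) (aux_local b M (insert 1 S) (by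
          intro x i
          refine Submodule.span_mono (Set.image_mono ?_) (hloc x i)
          intro z hz
          simp only [Set.mem_ofPred_eq] at hz ⊢
          exact Finset.mem_insert_of_mem hz) k x i)
        rintro ⟨y, j⟩ hy
        simp only [Set.mem_ofPred_eq] at hy
        have h2 : x⁻¹ * y ∈ K := Finset.pow_subset_pow_right (Finset.mem_insert_self _ _) hk hy
        have h3 := hxK _ h2
        rw [mul_inv_cancel_left] at h3
        simp [hF', h3]) p le_rfl
      rw [hdiag] at h1
      have h4 := congrArg Complex.re h1
      rw [Complex.ofReal_re] at h4
      rw [← htx x i]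
      exact h4.symm
    have hLnn : ∀ w : F', 0 ≤ L := by
      intro w
      exact (norm_nonneg _).trans (hL _ (hlam w))
    have hDle : ∀ w : F', D w ≤ t (w : Γ × ι).2 +
        if (w : Γ × ι).1 ∈ bd then |t (w : Γ × ι).2| + L else 0 := by
      intro w
      split_ifs with h
      · have := hDL w
        have := neg_abs_le (t (w : Γ × ι).2)
        linarith
      · rw [hDint w h, add_zero]
    have hsum : ∑ w, D w ≤ F.card * ∑ i, t i + bd.card * Q := by
      refine (Finset.sum_le_sum fun w _ => hDle w).trans ?_
      rw [Finset.sum_coe_sort F' (fun z : Γ × ι => t z.2 + if z.1 ∈ bd then |t z.2| + L else 0),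
        hF', Finset.sum_product]
      simp only [Finset.sum_add_distrib]
      refine add_le_add ?_ ?_
      · rw [Finset.sum_const, nsmul_eq_mul]
      · have : ∀ x ∈ F, (∑ i, if x ∈ bd then |t i| + L else 0) = if x ∈ bd then Q else 0 := by
          intro x _
          split_ifs <;> simp [hQ]
        rw [Finset.sum_congr rfl this, ← Finset.sum_filter, Finset.sum_const, nsmul_eq_mul]
        apply le_of_eq
        congr 3
        ext x
        simp only [Finset.mem_filter, hbddef]
        tauto
    have hQ0 : 0 ≤ Q := by
      apply Finset.sum_nonneg
      intro i _
      obtain ⟨x, hx⟩ := hF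
      have := hLnn ⟨(x, i), by simp [hF', hx]⟩
      positivity
    have hFpos : (0 : ℝ) < F.card := by exact_mod_cast hF.card_pos
    have h9 : (bd.card : ℝ) * Q ≤ η * F.card * Q := mul_le_mul_of_nonneg_right hbd hQ0
    have h10 : 0 ≤ (F.card : ℝ) * (∑ i, t i + ε * n + η * Q) := by
      nlinarith
    exact nonneg_of_mul_nonneg_right h10 hFpos
  have hlim : Filter.Tendsto (fun η : ℝ => ∑ i, t i + ε * n + η * Q) (nhdsWithin 0 (Set.Ioi 0))
      (nhds (∑ i, t i + ε * n + 0 * Q)) := by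
    apply tendsto_nhdsWithin_of_tendsto_nhds
    exact Continuous.tendsto (by fun_prop) 0
  have := ge_of_tendsto hlim (b := 0) (by
    filter_upwards [self_mem_nhdsWithin] with η hη using claim η hη)
  simpa using this

theorem aux_main (ham : IsAmenable Γ) {ι H : Type} [Fintype ι]
    [DecidableEq ι] [DecidableEq Γ]
    [NormedAddCommGroup H] [InnerProductSpace ℂ H] [CompleteSpace H]
    (b : Γ × ι → H) (hb : Orthonormal ℂ b) (M : H →L[ℂ] H) (hsa : IsSelfAdjoint M)
    (c C : ℝ) (hc : 0 < c)
    (hlo : ∀ v, c * ‖v‖ ^ 2 ≤ (inner ℂ v (M v) : ℂ).re)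
    (hhi : ∀ v, (inner ℂ v (M v) : ℂ).re ≤ C * ‖v‖ ^ 2)
    (S : Finset Γ)
    (hloc : ∀ x i, M (b (x, i)) ∈ Submodule.span ℂ (b '' {z | x⁻¹ * z.1 ∈ S}))
    (hint : ∀ z w, ∃ k : ℤ, (inner ℂ (b z) (M (b w)) : ℂ) = k)
    (U : Γ → H ≃ₗᵢ[ℂ] H) (hU : ∀ g i, U g (b (1, i)) = b (g, i))
    (hUM : ∀ g v, U g (M v) = M (U g v)) :
    0 ≤ ∑ i, (inner ℂ (b (1, i)) ((cfc Real.log M) (b (1, i))) : ℂ).re := by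
  have hspec := aux_spec M hsa c C hlo hhi
  apply le_of_forall_pos_le_add
  intro δ hδ
  set n : ℝ := (Fintype.card ι : ℝ) with hn
  set ε : ℝ := δ / (2 * n + 1) with hε
  have hn0 : 0 ≤ n := Nat.cast_nonneg _
  have hε0 : 0 < ε := by positivity
  have hlogc : ContinuousOn Real.log (Set.Icc c C) :=
    Real.continuousOn_log.mono (fun x hx => (lt_of_lt_of_le hc hx.1).ne')
  obtain ⟨p, hp⟩ := exists_polynomial_near_of_continuousOn c C Real.log hlogc ε hε0
  have h1 := aux_poly ham b hb M hsa c C hc hlo hhi S hloc hint U hU hUM p ε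
    (fun x hx => (hp x hx).le)
  have hnorm : ‖cfc Real.log M - Polynomial.aeval M p‖ ≤ ε := by
    rw [← cfc_polynomial p M hsa, ← cfc_sub Real.log (fun x => p.eval x) M
      (hlogc.mono (fun x hx => hspec x hx)) p.continuous.continuousOn]
    refine norm_cfc_le hε0.le ?_
    intro x hx
    rw [Real.norm_eq_abs, abs_sub_comm]
    exact (hp x (hspec x hx)).le
  have h2 : ∀ i, (inner ℂ (b (1, i)) ((Polynomial.aeval M p) (b (1, i))) : ℂ).re ≤
      (inner ℂ (b (1, i)) ((cfc Real.log M) (b (1, i))) : ℂ).re + ε := by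
    intro i
    have h3 : ‖(inner ℂ (b (1, i)) ((cfc Real.log M - Polynomial.aeval M p) (b (1, i))) : ℂ)‖
        ≤ ε := by
      refine (norm_inner_le_norm _ _).trans ?_
      rw [hb.1, one_mul]
      refine (ContinuousLinearMap.le_opNorm _ _).trans ?_
      rwa [hb.1, mul_one]
    have h4 := (abs_le.1 ((Complex.abs_re_le_norm _).trans h3)).1
    rw [sub_apply, inner_sub_right, Complex.sub_re] at h4
    linarith
  have h5 := Finset.sum_le_sum (fun i (_ : i ∈ Finset.univ) => h2 i)
  rw [Finset.sum_add_distrib, Finset.sum_const, Finset.card_univ, nsmul_eq_mul] at h5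
  have h6 : ε * (2 * n + 1) = δ := by
    rw [hε]; field_simp
  nlinarith

theorem translateL_memℓp (g : Γ) (f : l2 Γ) :
    Memℓp (fun x : Γ => f (g⁻¹ * x)) (2 : ℝ≥0∞) := by
  have h2 : (0:ℝ) < (2 : ℝ≥0∞).toReal := by norm_num
  apply memℓp_gen
  have hs : Summable fun i : Γ => ‖f i‖ ^ (2 : ℝ≥0∞).toReal := (lp.memℓp f).summable h2
  exact ((Equiv.mulLeft g⁻¹).summable_iff (f := fun i : Γ => ‖f i‖ ^ (2 : ℝ≥0∞).toReal)).2 hs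

/-- The left-translation unitary `(λ_g ξ)(x) = ξ(g⁻¹x)` on `ℓ²(Γ)`. -/
def lamEquiv (g : Γ) : l2 Γ ≃ₗᵢ[ℂ] l2 Γ where
  toFun f := ⟨fun x => f (g⁻¹ * x), translateL_memℓp g f⟩
  invFun f := ⟨fun x => f (g⁻¹⁻¹ * x), translateL_memℓp g⁻¹ f⟩
  left_inv f := by ext x; simp
  right_inv f := by ext x; simp
  map_add' f g := by ext x; simp; rfl
  map_smul' c f := by ext x; simp [lp.coeFn_smul]
  norm_map' f := by
    have h2 : (0:ℝ) < (2 : ℝ≥0∞).toReal := by norm_num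
    have h1 := lp.norm_rpow_eq_tsum h2
      (⟨fun x => f (g⁻¹ * x), translateL_memℓp g f⟩ : l2 Γ)
    have h3 := lp.norm_rpow_eq_tsum h2 f
    have h4 : ∑' x : Γ, ‖f (g⁻¹ * x)‖ ^ (2 : ℝ≥0∞).toReal
        = ∑' x : Γ, ‖f x‖ ^ (2 : ℝ≥0∞).toReal :=
      (Equiv.mulLeft g⁻¹).tsum_eq fun x => ‖f x‖ ^ (2 : ℝ≥0∞).toReal
    have h5 := h1.trans (h4.trans h3.symm)
    exact (Real.rpow_left_inj (norm_nonneg _) (norm_nonneg _) h2.ne').1 h5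

theorem rho_apply (γ : Γ) (f : l2 Γ) (x : Γ) : rho γ f x = f (x * γ) := rfl

theorem lamEquiv_apply (g : Γ) (f : l2 Γ) (x : Γ) : lamEquiv g f x = f (g⁻¹ * x) := rfl

theorem rho_single [DecidableEq Γ] (γ x : Γ) :
    rho γ (lp.single 2 x (1 : ℂ) : l2 Γ) = lp.single 2 (x * γ⁻¹) (1 : ℂ) := by
  ext y
  rw [rho_apply, lp.single_apply, lp.single_apply, Pi.single_apply, Pi.single_apply]
  simp only [eq_mul_inv_iff_mul_eq]

theorem lam_single [DecidableEq Γ] (g x : Γ) :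
    lamEquiv g (lp.single 2 x (1 : ℂ) : l2 Γ) = lp.single 2 (g * x) (1 : ℂ) := by
  ext y
  rw [lamEquiv_apply, lp.single_apply, lp.single_apply, Pi.single_apply, Pi.single_apply]
  simp only [inv_mul_eq_iff_eq_mul]

theorem rho_lam (g γ : Γ) (f : l2 Γ) : lamEquiv g (rho γ f) = rho γ (lamEquiv g f) := by
  ext y
  rw [lamEquiv_apply, rho_apply, rho_apply, lamEquiv_apply, mul_assoc]

theorem rho_inner (γ : Γ) (f h : l2 Γ) :
    (inner ℂ (rho γ f) h : ℂ) = inner ℂ f (rho γ⁻¹ h) := by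
  have : rho γ (rho γ⁻¹ h) = h := by
    ext y; rw [rho_apply, rho_apply]; simp
  conv_lhs => rw [← this]
  exact (rhoEquiv γ).inner_map_map _ _

/-- The right regular representation as a monoid homomorphism. -/
def rhoHom (Γ : Type) [Group Γ] : Γ →* (l2 Γ →L[ℂ] l2 Γ) where
  toFun := rho
  map_one' := by
    ext f y
    show f (y * 1) = f y
    rw [mul_one]
  map_mul' a b := by
    ext f y
    show f (y * (a * b)) = f (y * a * b)
    rw [mul_assoc]

theorem Rop_eq (a : MonoidAlgebra ℤ Γ) :
    Rop a = MonoidAlgebra.lift ℤ (l2 Γ →L[ℂ] l2 Γ) Γ (rhoHom Γ) a := by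
  rw [MonoidAlgebra.lift_apply, Rop]
  refine Finset.sum_congr rfl fun γ _ => ?_
  exact Int.cast_smul_eq_zsmul ℂ _ _

section Conc

variable {ι : Type} [Fintype ι] [DecidableEq ι]

/-- The elementary operators. -/
def Eop (i j : ι) (γ : Γ) : Hn Γ ι →L[ℂ] Hn Γ ι :=
  (inclL Γ i).comp ((rho γ).comp (projL Γ j))

theorem projL_apply (j : ι) (v : Hn Γ ι) : projL Γ j v = v j := rfl

theorem inclL_apply (i : ι) (f : l2 Γ) (k : ι) : inclL Γ i f k = if k = i then f else 0 := by
  show (Pi.single i f : ι → l2 Γ) k = _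
  rw [Pi.single_apply]

theorem inclL_inner (i : ι) (f : l2 Γ) (v : Hn Γ ι) :
    (inner ℂ (inclL Γ i f) v : ℂ) = inner ℂ f (v i) := by
  rw [PiLp.inner_apply, Finset.sum_eq_single i]
  · rw [inclL_apply, if_pos rfl]
  · intro k _ hk
    rw [inclL_apply, if_neg hk, inner_zero_left]
  · simp

theorem Eop_inner (i j : ι) (γ : Γ) (u v : Hn Γ ι) :
    (inner ℂ (Eop i j γ u) v : ℂ) = inner ℂ u (Eop j i γ⁻¹ v) := by
  show (inner ℂ (inclL Γ i (rho γ (u j))) v : ℂ) = inner ℂ u (inclL Γ j (rho γ⁻¹ (v i)))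
  rw [inclL_inner, ← inner_conj_symm u, inclL_inner, inner_conj_symm, rho_inner]

theorem Eop_star (i j : ι) (γ : Γ) : star (Eop i j γ) = Eop j i γ⁻¹ := by
  rw [ContinuousLinearMap.star_eq_adjoint]
  symm
  rw [ContinuousLinearMap.eq_adjoint_iff]
  intro u v
  rw [Eop_inner, inv_inv]

/-- The basis vectors. -/
def bvec [DecidableEq Γ] (z : Γ × ι) : Hn Γ ι := inclL Γ z.2 (lp.single 2 z.1 (1 : ℂ))

theorem bvec_orthonormal [DecidableEq Γ] : Orthonormal ℂ (bvec : Γ × ι → Hn Γ ι) := by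
  rw [orthonormal_iff_ite]
  rintro ⟨x, i⟩ ⟨y, j⟩
  unfold bvec
  rw [inclL_inner, inclL_apply, lp.inner_single_left]
  by_cases hij : i = j
  · subst hij
    by_cases hxy : x = y
    · subst hxy; simp
    · simp [hxy]
  · simp [hij]

theorem Eop_bvec [DecidableEq Γ] (i j : ι) (γ x : Γ) (k : ι) :
    Eop i j γ (bvec (x, k)) = if j = k then bvec (x * γ⁻¹, i) else 0 := by
  show inclL Γ i (rho γ (inclL Γ k (lp.single 2 x (1 : ℂ)) j)) = _
  rw [inclL_apply]
  split_ifs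
  · rw [rho_single]; rfl
  · simp

/-- Left translation on `ℓ²(Γ)ⁿ`. -/
def Uop (g : Γ) : Hn Γ ι ≃ₗᵢ[ℂ] Hn Γ ι :=
  LinearIsometryEquiv.piLpCongrRight 2 (fun _ => lamEquiv g)

theorem Uop_apply (g : Γ) (v : Hn Γ ι) (i : ι) : Uop g v i = lamEquiv g (v i) := rfl

theorem Uop_incl (g : Γ) (i : ι) (f : l2 Γ) :
    Uop g (inclL Γ i f) = inclL Γ i (lamEquiv g f) := by
  ext1 k
  rw [Uop_apply, inclL_apply, inclL_apply]
  split_ifs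
  · rfl
  · simp

theorem Uop_bvec [DecidableEq Γ] (g x : Γ) (i : ι) :
    Uop g (bvec (x, i)) = bvec (g * x, i) := by
  unfold bvec
  rw [Uop_incl, lam_single]

theorem Uop_Eop (g : Γ) (i j : ι) (γ : Γ) (v : Hn Γ ι) :
    Uop g (Eop i j γ v) = Eop i j γ (Uop g v) := by
  show Uop g (inclL Γ i (rho γ (v j))) = inclL Γ i (rho γ (lamEquiv g (v j)))
  rw [Uop_incl, rho_lam]

/-- The ring of integral operators. -/
def Gring (Γ : Type) [Group Γ] (ι : Type) [Fintype ι] [DecidableEq ι] :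
    Subring (Hn Γ ι →L[ℂ] Hn Γ ι) :=
  Subring.closure {T | ∃ i j γ, T = Eop i j γ}

theorem Gring_star (T : Hn Γ ι →L[ℂ] Hn Γ ι) (hT : T ∈ Gring Γ ι) : star T ∈ Gring Γ ι := by
  induction hT using Subring.closure_induction with
  | mem x hx =>
    obtain ⟨i, j, γ, rfl⟩ := hx
    rw [Eop_star]
    exact Subring.subset_closure ⟨_, _, _, rfl⟩
  | zero => rw [star_zero]; exact zero_mem _
  | one => rw [star_one]; exact one_mem _
  | add x y _ _ hx hy => exact (star_add x y) ▸ add_mem hx hy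
  | neg x _ hx => exact (star_neg x) ▸ neg_mem hx
  | mul x y _ _ hx hy => rw [star_mul]; exact mul_mem hy hx

theorem Gring_U (T : Hn Γ ι →L[ℂ] Hn Γ ι) (hT : T ∈ Gring Γ ι) (g : Γ) :
    ∀ v, Uop g (T v) = T (Uop g v) := by
  induction hT using Subring.closure_induction with
  | mem x hx =>
    obtain ⟨i, j, γ, rfl⟩ := hx
    exact Uop_Eop g i j γ
  | zero => intro v; simp
  | one => intro v; rfl
  | add x y _ _ hx hy => intro v; rw [add_apply, add_apply, map_add, hx, hy]
  | neg x _ hx => intro v; rw [neg_apply, neg_apply, map_neg, hx]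
  | mul x y _ _ hx hy =>
    intro v
    show Uop g (x (y v)) = x (y (Uop g v))
    rw [hx, hy]

theorem Gring_int [DecidableEq Γ] (T : Hn Γ ι →L[ℂ] Hn Γ ι) (hT : T ∈ Gring Γ ι) :
    ∀ v ∈ AddSubgroup.closure (Set.range (bvec : Γ × ι → Hn Γ ι)),
      T v ∈ AddSubgroup.closure (Set.range (bvec : Γ × ι → Hn Γ ι)) := by
  induction hT using Subring.closure_induction with
  | mem x hx =>
    obtain ⟨i, j, γ, rfl⟩ := hx
    intro v hv
    induction hv using AddSubgroup.closure_induction with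
    | mem v hv =>
      obtain ⟨⟨x, k⟩, rfl⟩ := hv
      rw [Eop_bvec]
      split_ifs
      · exact AddSubgroup.subset_closure ⟨_, rfl⟩
      · exact zero_mem _
    | zero => rw [map_zero]; exact zero_mem _
    | add a b _ _ ha hb => rw [map_add]; exact add_mem ha hb
    | neg a _ ha => rw [map_neg]; exact neg_mem ha
  | zero => intro v _; exact zero_mem _
  | one => intro v hv; exact hv
  | add x y _ _ hx hy => intro v hv; exact add_mem (hx v hv) (hy v hv)
  | neg x _ hx => intro v hv; exact neg_mem (hx v hv)
  | mul x y _ _ hx hy => intro v hv; exact hx _ (hy v hv)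

theorem Gring_hint [DecidableEq Γ] (T : Hn Γ ι →L[ℂ] Hn Γ ι) (hT : T ∈ Gring Γ ι)
    (z w : Γ × ι) : ∃ k : ℤ, (inner ℂ (bvec z) (T (bvec w)) : ℂ) = k := by
  have h := Gring_int T hT (bvec w) (AddSubgroup.subset_closure ⟨_, rfl⟩)
  generalize T (bvec w) = v at h
  induction h using AddSubgroup.closure_induction with
  | mem v hv =>
    obtain ⟨y, rfl⟩ := hv
    rw [orthonormal_iff_ite.1 bvec_orthonormal z y]
    split_ifs
    · exact ⟨1, by simp⟩
    · exact ⟨0, by simp⟩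
  | zero => exact ⟨0, by simp⟩
  | add a b _ _ ha hb =>
    obtain ⟨k, hk⟩ := ha
    obtain ⟨l, hl⟩ := hb
    exact ⟨k + l, by rw [inner_add_right, hk, hl]; push_cast; rfl⟩
  | neg a _ ha =>
    obtain ⟨k, hk⟩ := ha
    exact ⟨-k, by rw [inner_neg_right, hk]; push_cast; rfl⟩

open scoped Pointwise in
theorem Gring_loc [DecidableEq Γ] (T : Hn Γ ι →L[ℂ] Hn Γ ι) (hT : T ∈ Gring Γ ι) :
    ∃ S : Finset Γ, ∀ x i, T (bvec (x, i)) ∈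
      Submodule.span ℂ ((bvec : Γ × ι → Hn Γ ι) '' {z | x⁻¹ * z.1 ∈ S}) := by
  induction hT using Subring.closure_induction with
  | mem x hx =>
    obtain ⟨i, j, γ, rfl⟩ := hx
    refine ⟨{γ⁻¹}, fun x k => ?_⟩
    rw [Eop_bvec]
    split_ifs
    · exact Submodule.subset_span ⟨(x * γ⁻¹, i), by simp, rfl⟩
    · exact zero_mem _
  | zero => exact ⟨∅, fun x i => zero_mem _⟩
  | one => exact ⟨{1}, fun x i => Submodule.subset_span ⟨(x, i), by simp, rfl⟩⟩
  | add x y _ _ hx hy =>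
    obtain ⟨S, hS⟩ := hx
    obtain ⟨S', hS'⟩ := hy
    refine ⟨S ∪ S', fun x i => add_mem ?_ ?_⟩
    · refine Submodule.span_mono (Set.image_mono ?_) (hS x i)
      intro z hz
      exact Finset.mem_union_left _ hz
    · refine Submodule.span_mono (Set.image_mono ?_) (hS' x i)
      intro z hz
      exact Finset.mem_union_right _ hz
  | neg x _ hx =>
    obtain ⟨S, hS⟩ := hx
    exact ⟨S, fun x i => neg_mem (hS x i)⟩
  | mul a b _ _ hx hy =>
    obtain ⟨S, hS⟩ := hx
    obtain ⟨S', hS'⟩ := hy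
    refine ⟨S' * S, fun x i => ?_⟩
    show a (b (bvec (x, i))) ∈ _
    have h := hS' x i
    generalize b (bvec (x, i)) = v at h
    induction h using Submodule.span_induction with
    | mem v hv =>
      obtain ⟨⟨y, j⟩, hy, rfl⟩ := hv
      refine Submodule.span_mono (Set.image_mono ?_) (hS y j)
      rintro ⟨u, l⟩ hu
      simp only [Set.mem_ofPred_eq] at hu hy ⊢
      exact Finset.mem_mul.2 ⟨_, hy, _, hu, by group⟩
    | zero => simp
    | add v w _ _ hv hw => rw [map_add]; exact Submodule.add_mem _ hv hw
    | smul a v _ hv => rw [map_smul]; exact Submodule.smul_mem _ _ hv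

end Conc

theorem RA_apply {ι κ : Type} [Fintype ι] [Fintype κ] (A : Matrix ι κ (MonoidAlgebra ℤ Γ))
    (v : Hn Γ κ) (i : ι) : RA A v i = ∑ j, Rop (A i j) (v j) := by
  letI := Classical.decEq ι
  show projL Γ i ((∑ i, ∑ j, (inclL Γ i).comp ((Rop (A i j)).comp (projL Γ j))) v) = _
  rw [sum_apply, map_sum, Finset.sum_eq_single i]
  · rw [sum_apply, map_sum]
    refine Finset.sum_congr rfl fun j _ => ?_
    show inclL Γ i (Rop (A i j) (v j)) i = _
    rw [inclL_apply, if_pos rfl]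
  · intro k _ hk
    rw [sum_apply, map_sum]
    refine Finset.sum_eq_zero fun j _ => ?_
    show inclL Γ k (Rop (A k j) (v j)) i = _
    rw [inclL_apply, if_neg (Ne.symm hk)]
  · simp

theorem RA_mul {ι : Type} [Fintype ι] (A B : Matrix ι ι (MonoidAlgebra ℤ Γ)) :
    RA (A * B) = RA A * RA B := by
  ext1 v
  ext1 i
  show RA (A * B) v i = RA A (RA B v) i
  rw [RA_apply, RA_apply]
  simp only [RA_apply, Matrix.mul_apply, Rop_eq, map_sum, map_mul, sum_apply]
  rw [Finset.sum_comm]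
  rfl

theorem RA_one {ι : Type} [Fintype ι] [DecidableEq ι] :
    RA (1 : Matrix ι ι (MonoidAlgebra ℤ Γ)) = 1 := by
  ext1 v
  ext1 i
  show _ = v i
  rw [RA_apply, Finset.sum_eq_single i]
  · rw [Matrix.one_apply_eq, Rop_eq, map_one]; rfl
  · intro j _ hj
    rw [Matrix.one_apply_ne (Ne.symm hj), Rop_eq, map_zero]; rfl
  · simp

theorem RA_mem {ι : Type} [Fintype ι] (A : Matrix ι ι (MonoidAlgebra ℤ Γ)) :
    letI := Classical.decEq ι
    RA A ∈ Gring Γ ι := by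
  letI := Classical.decEq ι
  show (∑ i, ∑ j, (inclL Γ i).comp ((Rop (A i j)).comp (projL Γ j))) ∈ Gring Γ ι
  refine sum_mem fun i _ => sum_mem fun j _ => ?_
  have : (inclL Γ i).comp ((Rop (A i j)).comp (projL Γ j)) =
      ∑ γ ∈ (A i j).coeff.support, ((A i j).coeff γ) • Eop i j γ := by
    ext1 v
    rw [sum_apply]
    show inclL Γ i (Rop (A i j) (v j)) = _
    rw [Rop, Finsupp.sum, sum_apply, map_sum]
    refine Finset.sum_congr rfl fun γ _ => ?_
    rw [Int.cast_smul_eq_zsmul]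
    show inclL Γ i ((A i j).coeff γ • (rho γ (v j))) = (A i j).coeff γ • inclL Γ i (rho γ (v j))
    rw [map_zsmul]
  rw [this]
  have hE : ∀ γ, Eop i j γ ∈ Gring Γ ι := fun γ => Subring.subset_closure ⟨i, j, γ, rfl⟩
  exact sum_mem fun γ _ => zsmul_mem (hE γ) _

theorem aux_nonneg (ham : IsAmenable Γ) {ι : Type} [Fintype ι] (V V' : Hn Γ ι →L[ℂ] Hn Γ ι)
    (hV : letI := Classical.decEq ι; V ∈ Gring Γ ι) (hVV : V' * V = 1) :
    0 ≤ (vnTrace (cfc Real.log (star V * V))).re := by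
  letI := Classical.decEq ι
  letI := Classical.decEq Γ
  have hMG : star V * V ∈ Gring Γ ι := mul_mem (Gring_star V hV) hV
  obtain ⟨S, hS⟩ := Gring_loc _ hMG
  have hq : ∀ v, (inner ℂ v ((star V * V) v) : ℂ).re = ‖V v‖ ^ 2 := by
    intro v
    show (inner ℂ v ((ContinuousLinearMap.adjoint V) (V v)) : ℂ).re = _
    rw [ContinuousLinearMap.adjoint_inner_right, @norm_sq_eq_re_inner ℂ]
    rfl
  have h := aux_main ham (bvec : Γ × ι → Hn Γ ι) bvec_orthonormal (star V * V)
    (IsSelfAdjoint.star_mul_self V) (1 / (‖V'‖ ^ 2 + 1)) (‖V‖ ^ 2) (by positivity)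
    (by
      intro v
      rw [hq, div_mul_eq_mul_div, one_mul, div_le_iff₀ (by positivity)]
      have h1 : ‖v‖ ≤ ‖V'‖ * ‖V v‖ := by
        have : V' (V v) = v := congrArg (fun T : Hn Γ ι →L[ℂ] Hn Γ ι => T v) hVV
        conv_lhs => rw [← this]
        exact V'.le_opNorm _
      have h2 : ‖v‖ ^ 2 ≤ (‖V'‖ * ‖V v‖) ^ 2 := by gcongr
      nlinarith [sq_nonneg ‖V v‖])
    (by
      intro v
      rw [hq, ← mul_pow]
      gcongr
      exact V.le_opNorm v)
    S hS (Gring_hint _ hMG) Uop (by intro g i; rw [Uop_bvec, mul_one])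
    (fun g v => Gring_U _ hMG g v)
  rw [vnTrace, Complex.re_sum]
  refine h.trans (le_of_eq ?_)
  refine Finset.sum_congr rfl fun i _ => ?_
  exact inner_re_symm (𝕜 := ℂ) _ _

theorem aux_final (ham : IsAmenable Γ) {ι : Type} [Fintype ι] [DecidableEq ι]
    (A B : Matrix ι ι (MonoidAlgebra ℤ Γ)) (hAB : A * B = 1) (hBA : B * A = 1) :
    (vnTrace (cfc Real.log (star (RA A) * RA A))).re = 0 := by
  have h1 : RA A * RA B = 1 := by rw [← RA_mul, hAB, RA_one]
  have h2 : RA B * RA A = 1 := by rw [← RA_mul, hBA, RA_one]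
  have hpos := aux_nonneg ham (RA A) (RA B) (RA_mem A) h2
  have hneg := aux_nonneg ham (star (RA B)) (star (RA A))
    (by letI := Classical.decEq ι; exact Gring_star _ (RA_mem B))
    (by rw [← star_mul, h2, star_one])
  rw [star_star] at hneg
  let u : (Hn Γ ι →L[ℂ] Hn Γ ι)ˣ :=
    ⟨star (RA A) * RA A, RA B * star (RA B), by
      rw [mul_assoc, ← mul_assoc (RA A), h1, one_mul, ← star_mul, h2, star_one], by
      rw [mul_assoc, ← mul_assoc (star (RA B)), ← star_mul, h1, star_one, one_mul, h2]⟩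
  have hu : (u : Hn Γ ι →L[ℂ] Hn Γ ι) = star (RA A) * RA A := rfl
  have hu' : ((u⁻¹ : (Hn Γ ι →L[ℂ] Hn Γ ι)ˣ) : Hn Γ ι →L[ℂ] Hn Γ ι) = RA B * star (RA B) := rfl
  have hlog : cfc Real.log (RA B * star (RA B)) = - cfc Real.log (star (RA A) * RA A) := by
    rw [← hu', ← cfc_comp_inv Real.log u (by
      refine Real.continuousOn_log.mono ?_
      rintro _ ⟨x, hx, rfl⟩
      have : x ≠ 0 := spectrum.ne_zero_of_mem_of_unit hx
      simpa using this) (IsSelfAdjoint.star_mul_self (RA A)), hu, ← cfc_neg]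
    simp only [Real.log_inv]
  rw [hlog] at hneg
  have : vnTrace (- cfc Real.log (star (RA A) * RA A)) =
      - vnTrace (cfc Real.log (star (RA A) * RA A)) := by
    simp only [vnTrace, neg_apply, inner_neg_left, Finset.sum_neg_distrib]
  rw [this, Complex.neg_re] at hneg
  linarith

/-- **Triviality of the Fuglede–Kadison determinant on `Wh(Γ)` for finitely presented
amenable groups.**  Let `Γ` be a countable, finitely presented, amenable group, `n ≥ 1`,
and let `A` be an `n × n` matrix over `ℤΓ` which is invertible over `ℤΓ`.  Then the
Fuglede–Kadison determinant of the induced operator `R_A` on `ℓ²(Γ)ⁿ` equals `1`;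
equivalently `Re τ(log (R_A* R_A)) = 0`. -/
theorem FKdet_eq_one_of_invertible_matrix_of_amenable
    (Γ : Type) [Group Γ] [Countable Γ]
    (hfp : IsFinitelyPresented Γ) (ham : IsAmenable Γ)
    (n : ℕ) (hn : 1 ≤ n)
    (A : Matrix (Fin n) (Fin n) (MonoidAlgebra ℤ Γ))
    (hA : ∃ B : Matrix (Fin n) (Fin n) (MonoidAlgebra ℤ Γ), A * B = 1 ∧ B * A = 1) :
    FKdet (RA A) = 1 ∧ (vnTrace (cfc Real.log (star (RA A) * RA A))).re = 0 := by
  obtain ⟨B, hAB, hBA⟩ := hA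
  have h := aux_final ham A B hAB hBA
  refine ⟨?_, h⟩
  rw [FKdet, h, mul_zero, Real.exp_zero]
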